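/- arXiv:2205.10488 — 6 statements merged into one kernel-verified Lean document; each statement's English description precedes it below -/
import Mathlib

section
/- Let A ⊆ F₂ⁿ be a linear subspace, let d ≥ 1 and m ≥ 1, and let p₁, …, p_m be drawn independently and uniformly at random from the finite set I_{d,A}. Define Z = {v ∈ F₂ⁿ : pᵢ(v) = 0 for all 1 ≤ i ≤ m}. Then A ⊆ Z always holds, and the probability that A = Z is at least 1 − 2^{n−m}. -/
open MvPolynomial

/-- If every `φ v` with `v ∈ S` is surjective onto `H`, then the proportion of `m`-tuples of `G`
lying in the kernel of some `φ v`, `v ∈ S`, is at most `|ι| / |H| ^ m`. -/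
theorem card_exists_forall_apply_eq_zero_mul_le {G H ι : Type*} [AddGroup G] [Finite G]
    [AddGroup H] [Fintype ι] (m : ℕ) (φ : ι → G →+ H) (S : Set ι)
    (hφ : ∀ v ∈ S, Function.Surjective (φ v)) :
    Nat.card {p : Fin m → G // ∃ v ∈ S, ∀ i, φ v (p i) = 0} * Nat.card H ^ m ≤
      Fintype.card ι * Nat.card (Fin m → G) := by
  classical
  have hker (v : ι) (hv : v ∈ S) :
      Nat.card {p : Fin m → G // ∀ i, φ v (p i) = 0} * Nat.card H ^ m =
        Nat.card (Fin m → G) := by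
    have hG : Nat.card (φ v).ker * Nat.card H = Nat.card G := by
      rw [← (φ v).ker.card_mul_index, AddSubgroup.index_ker,
        AddMonoidHom.range_eq_top.2 (hφ v hv), AddSubgroup.card_top]
    have hpi : Nat.card {p : Fin m → G // ∀ i, φ v (p i) = 0} = Nat.card (φ v).ker ^ m := by
      rw [Nat.card_congr (Equiv.subtypePiEquivPi (p := fun (_ : Fin m) x => φ v x = 0)),
        Nat.card_pi, Finset.prod_const, Finset.card_univ, Fintype.card_fin]
      rfl
    rw [hpi, ← mul_pow, hG, Nat.card_fun, Nat.card_fin]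
  have hunion : Nat.card {p : Fin m → G // ∃ v ∈ S, ∀ i, φ v (p i) = 0} ≤
      ∑ v with v ∈ S, Nat.card {p : Fin m → G // ∀ i, φ v (p i) = 0} := by
    have := Finset.set_ncard_biUnion_le {v : ι | v ∈ S}
      (fun v => {p : Fin m → G | ∀ i, φ v (p i) = 0})
    simpa [← Nat.card_coe_set_eq, Set.ext_iff, Set.iUnion_ofPred, Set.coe_ofPred] using this
  calc _ ≤ (∑ v with v ∈ S, Nat.card {p : Fin m → G // ∀ i, φ v (p i) = 0}) * Nat.card H ^ m :=
        Nat.mul_le_mul_right _ hunion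
    _ = ∑ v with v ∈ S, Nat.card (Fin m → G) := by
        rw [Finset.sum_mul]
        exact Finset.sum_congr rfl fun v hv => hker v (by simpa using hv)
    _ ≤ Fintype.card ι * Nat.card (Fin m → G) := by
        rw [Finset.sum_const, smul_eq_mul]
        exact Nat.mul_le_mul_right _ (Finset.card_le_univ _)

/-- A point outside a linear subspace is separated from it by a polynomial of degree at most one
that vanishes on the subspace and takes a prescribed value at the point. -/
theorem Submodule.exists_totalDegree_le_one_eval_eq {K σ : Type*} [Field K] [Fintype σ]
    (A : Submodule K (σ → K)) {v : σ → K} (hv : v ∉ A) (c : K) :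
    ∃ p : MvPolynomial σ K, p.totalDegree ≤ 1 ∧ (∀ a ∈ A, eval a p = 0) ∧ eval v p = c := by
  classical
  obtain ⟨f, hfv, hfA⟩ := A.exists_le_ker_of_notMem hv
  let g := (c / f v) • f
  have heval (a : σ → K) : eval a (∑ i, g (Pi.single i 1) • X i) = g a := by
    conv_rhs => rw [pi_eq_sum_univ' a]
    simp [smul_eval, mul_comm]
  refine ⟨∑ i, g (Pi.single i 1) • X i, ?_, fun a ha => ?_, ?_⟩
  · refine totalDegree_finsetSum_le fun i _ => (totalDegree_smul_le _ _).trans ?_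
    rw [totalDegree_X]
  · rw [heval, LinearMap.smul_apply, LinearMap.mem_ker.1 (hfA ha), smul_zero]
  · rw [heval, LinearMap.smul_apply, smul_eq_mul, div_mul_cancel₀ c hfv]

/-- Let `A ⊆ F₂ⁿ` be a linear subspace, `d ≥ 1`, `m ≥ 1`, and let `p₁, …, p_m` be drawn
independently and uniformly at random from `I_{d,A}`, the set of polynomials of total degree
at most `d` vanishing on `A`.  With `Z = {v : ∀ i, pᵢ(v) = 0}`, we always have `A ⊆ Z`,
and `Pr[A = Z] ≥ 1 - 2^(n-m)` for the uniform distribution on `(I_{d,A})^m`. -/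
theorem stmt_0 (n d m : ℕ) (hd : 1 ≤ d) (hm : 1 ≤ m)
    (A : Submodule (ZMod 2) (Fin n → ZMod 2))
    (I : Set (MvPolynomial (Fin n) (ZMod 2)))
    (hI : I = {p | p.totalDegree ≤ d ∧ ∀ a ∈ A, eval a p = 0})
    (Z : (Fin m → I) → Set (Fin n → ZMod 2))
    (hZ : ∀ p : Fin m → I,
      Z p = {v | ∀ i : Fin m, eval v ((p i : MvPolynomial (Fin n) (ZMod 2))) = 0}) :
    (∀ p : Fin m → I, (A : Set (Fin n → ZMod 2)) ⊆ Z p) ∧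
    ((Nat.card {p : Fin m → I // (A : Set (Fin n → ZMod 2)) = Z p} : ℝ) /
        (Nat.card (Fin m → I) : ℝ)) ≥ 1 - (2 : ℝ) ^ ((n : ℤ) - (m : ℤ)) := by
  let V : Submodule (ZMod 2) (MvPolynomial (Fin n) (ZMod 2)) :=
    restrictTotalDegree (Fin n) (ZMod 2) d ⊓
      (vanishingIdeal (ZMod 2) (A : Set (Fin n → ZMod 2))).restrictScalars (ZMod 2)
  have hV (p : MvPolynomial (Fin n) (ZMod 2)) :
      p ∈ V ↔ p.totalDegree ≤ d ∧ ∀ a ∈ A, eval a p = 0 := by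
    simp [V, mem_restrictTotalDegree, aeval_eq_eval]
  obtain rfl : I = V := hI.trans (Set.ext fun p => (hV p).symm)
  have hsub (p : Fin m → V) : (A : Set (Fin n → ZMod 2)) ⊆ Z p := by
    rw [hZ]
    exact fun a ha i => ((hV _).1 (p i).2).2 a ha
  refine ⟨hsub, ?_⟩
  have : Finite V :=
    have : Finite (restrictTotalDegree (Fin n) (ZMod 2) d) := Module.finite_of_finite (ZMod 2)
    Finite.of_injective _ (Submodule.inclusion_injective (inf_le_left : V ≤ _))
  let φ (v : Fin n → ZMod 2) : V →+ ZMod 2 := (eval v).toAddMonoidHom.comp V.subtype.toAddMonoidHom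
  have hφ : ∀ v ∈ (A : Set (Fin n → ZMod 2))ᶜ, Function.Surjective (φ v) := by
    intro v hv c
    obtain ⟨p, hp, hpA, hpv⟩ := A.exists_totalDegree_le_one_eval_eq hv c
    exact ⟨⟨p, (hV p).2 ⟨hp.trans hd, hpA⟩⟩, hpv⟩
  have hbad := card_exists_forall_apply_eq_zero_mul_le m φ _ hφ
  have hne (p : Fin m → V) :
      (∃ v ∈ (A : Set (Fin n → ZMod 2))ᶜ, ∀ i, φ v (p i) = 0) ↔
        ¬ (A : Set (Fin n → ZMod 2)) = Z p := by
    rw [Set.Subset.antisymm_iff, and_iff_right (hsub p), Set.not_subset, hZ]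
    exact exists_congr fun v => and_comm
  rw [Nat.card_congr (Equiv.subtypeEquivRight hne)] at hbad
  have hsplit : Nat.card {p : Fin m → V // (A : Set (Fin n → ZMod 2)) = Z p} +
      Nat.card {p : Fin m → V // ¬ (A : Set (Fin n → ZMod 2)) = Z p} =
        Nat.card (Fin m → V) := by
    classical
    rw [← Nat.card_sum, Nat.card_congr (Equiv.sumCompl _)]
  have hpos : (0 : ℝ) < Nat.card (Fin m → V) := by exact_mod_cast Nat.card_pos
  simp only [Nat.card_zmod, Fintype.card_fun, ZMod.card, Fintype.card_fin] at hbad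
  have hbad' : (Nat.card {p : Fin m → V // ¬ (A : Set (Fin n → ZMod 2)) = Z p} : ℝ) * 2 ^ m ≤
      2 ^ n * Nat.card (Fin m → V) := by exact_mod_cast hbad
  have hsplit' : (Nat.card {p : Fin m → V // (A : Set (Fin n → ZMod 2)) = Z p} : ℝ) =
      Nat.card (Fin m → V) - Nat.card {p : Fin m → V // ¬ (A : Set (Fin n → ZMod 2)) = Z p} :=
    eq_sub_of_add_eq (by exact_mod_cast hsplit)
  rw [zpow_sub₀ two_ne_zero, zpow_natCast, zpow_natCast]
  change _ ≤ (Nat.card {p : Fin m → V // (A : Set (Fin n → ZMod 2)) = Z p} : ℝ) /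
    (Nat.card (Fin m → V) : ℝ)
  rw [hsplit', sub_div, div_self hpos.ne', sub_le_sub_iff_left, div_le_div_iff₀ hpos (by positivity)]
  exact hbad'
end

section
/- Let A ⊆ F₂ⁿ be a linear subspace, let d ≥ 1, and let v ∈ F₂ⁿ with v ∉ A. Then exactly half of the elements of I_{d,A} vanish at v; that is, 2 · #{p ∈ I_{d,A} : p(v) = 0} = #I_{d,A}. -/
open MvPolynomial

/-- A linear functional on `σ → R` is the evaluation of a polynomial of total degree at most one. -/
theorem LinearMap.exists_totalDegree_le_one_eval_eq {σ R : Type*} [Fintype σ]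
    [CommSemiring R] [Nontrivial R]
    (f : (σ → R) →ₗ[R] R) :
    ∃ l : MvPolynomial σ R, l.totalDegree ≤ 1 ∧ ∀ x, eval x l = f x := by
  classical
  refine ⟨∑ i, C (f (Pi.single i 1)) * X i, ?_, fun x => ?_⟩
  · refine totalDegree_finsetSum_le fun i _ => (totalDegree_mul _ _).trans ?_
    simp
  · rw [LinearMap.pi_apply_eq_sum_univ f x]
    simp only [map_sum, map_mul, eval_C, eval_X, smul_eq_mul]
    refine Finset.sum_congr rfl fun i _ => ?_
    rw [mul_comm]
    congr 2
    ext j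
    simp [Pi.single_apply, eq_comm]

/-- Let `A ⊆ F₂ⁿ` be a linear subspace, `d ≥ 1`, and `v ∉ A`.  Exactly half of the elements
of `I_{d,A}` (polynomials of total degree at most `d` vanishing on `A`) vanish at `v`. -/
theorem stmt_2 (n d : ℕ) (hd : 1 ≤ d) (A : Submodule (ZMod 2) (Fin n → ZMod 2))
    (v : Fin n → ZMod 2) (hv : v ∉ A) :
    2 * Nat.card {p : MvPolynomial (Fin n) (ZMod 2) //
        p.totalDegree ≤ d ∧ (∀ a ∈ A, eval a p = 0) ∧ eval v p = 0} =
      Nat.card {p : MvPolynomial (Fin n) (ZMod 2) //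
        p.totalDegree ≤ d ∧ ∀ a ∈ A, eval a p = 0} := by
  obtain ⟨f, hfv, hfA⟩ := Submodule.exists_le_ker_of_notMem hv
  obtain ⟨l, hl, hlf⟩ := f.exists_totalDegree_le_one_eval_eq
  have hlv : eval v l = 1 := by
    rw [hlf]
    exact Fin.eq_one_of_ne_zero _ hfv
  have hlA : ∀ a ∈ A, eval a l = 0 := fun a ha => (hlf a).trans (hfA ha)
  have hdeg : ∀ c : ZMod 2, (c • l).totalDegree ≤ d := fun c =>
    (totalDegree_smul_le c l).trans (hl.trans hd)
  have h2 : Nat.card (ZMod 2) = 2 := Nat.card_zmod 2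
  nth_rw 1 [← h2]
  rw [← Nat.card_prod]
  refine Nat.card_congr
    { toFun := fun x => ⟨x.2.1 + x.1 • l,
        (totalDegree_add _ _).trans (max_le x.2.2.1 (hdeg _)),
        fun a ha => by simp [smul_eval, x.2.2.2.1 a ha, hlA a ha]⟩
      invFun := fun q => (eval v q.1, ⟨q.1 - eval v q.1 • l,
        (totalDegree_sub _ _).trans (max_le q.2.1 (hdeg _)),
        fun a ha => by simp [smul_eval, q.2.2 a ha, hlA a ha],
        by simp [smul_eval, hlv]⟩)
      left_inv := ?_
      right_inv := ?_ }
  · rintro ⟨c, p, hp, hpA, hpv⟩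
    simp [smul_eval, hlv, hpv]
  · rintro ⟨q, hq⟩
    simp
end

section
/- Let A ⊆ F₂ⁿ be a linear subspace, let d ≥ 1, and let x ∈ A. Then the map D_x sending f to the homogeneous linear polynomial Σⱼ (pderiv_j f)(x) · Xⱼ is F₂-linear on J_{d,A}, its image is contained in L_A, and it is surjective onto L_A. -/
open MvPolynomial

/-- The partial derivatives of a linear form are its coefficients. -/
theorem pderiv_sum_C_mul_X {R σ : Type*} [CommSemiring R] [Fintype σ] (c : σ → R) (i : σ) :
    pderiv i (∑ j, C (c j) * X j) = C (c i) := by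
  classical
  simp [pderiv_X, Pi.single_apply]

theorem totalDegree_sum_C_mul_X_le {R σ : Type*} [CommSemiring R] [Fintype σ] (c : σ → R) :
    (∑ j, C (c j) * X j : MvPolynomial σ R).totalDegree ≤ 1 := by
  refine totalDegree_finsetSum_le fun j _ => ?_
  rw [C_mul_X_eq_monomial]
  exact (totalDegree_monomial_le _ _).trans (by simp)

/-- If every element of `L` vanishes at `x` and has zero directional derivative at `x` along `a`,
then so does every element of the ideal generated by `L`. -/
theorem sum_eval_pderiv_mul_eq_zero_of_mem_span {R σ : Type*} [CommRing R] [Fintype σ]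
    {L : Set (MvPolynomial σ R)} {x a : σ → R} (hx : ∀ l ∈ L, eval x l = 0)
    (ha : ∀ l ∈ L, ∑ j, eval x (pderiv j l) * a j = 0)
    {f : MvPolynomial σ R} (hf : f ∈ Ideal.span L) :
    eval x f = 0 ∧ ∑ j, eval x (pderiv j f) * a j = 0 := by
  induction hf using Submodule.span_induction with
  | mem l hl => exact ⟨hx l hl, ha l hl⟩
  | zero => simp
  | add f g _ _ hf hg =>
    simp [add_mul, Finset.sum_add_distrib, hf.1, hf.2, hg.1, hg.2]
  | smul g f _ hf =>
    refine ⟨by simp [hf.1], ?_⟩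
    simp [Derivation.leibniz, hf.1, mul_assoc, ← Finset.mul_sum, hf.2]

/-- Let `A ⊆ F₂ⁿ` be a linear subspace, `d ≥ 1`, and `x ∈ A`.  Let `L` be the set of
homogeneous linear polynomials vanishing on `A`, and let `J = J_{d,A}` be the set of
elements of the ideal generated by `L` of total degree at most `d`.  Then the map
`D_x : f ↦ ∑ⱼ (pderiv j f)(x) · Xⱼ` is `F₂`-linear on `J`, maps `J` into `L`, and is
surjective onto `L`. -/
theorem stmt_6 (n d : ℕ) (hd : 1 ≤ d)
    (A : Submodule (ZMod 2) (Fin n → ZMod 2))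
    (L : Set (MvPolynomial (Fin n) (ZMod 2)))
    (hL : L = {h | (∃ c : Fin n → ZMod 2, h = ∑ j, C (c j) * X j) ∧ ∀ a ∈ A, eval a h = 0})
    (J : Set (MvPolynomial (Fin n) (ZMod 2)))
    (hJ : J = {f | f ∈ Ideal.span L ∧ f.totalDegree ≤ d})
    (x : Fin n → ZMod 2) (hx : x ∈ A)
    (D : MvPolynomial (Fin n) (ZMod 2) → MvPolynomial (Fin n) (ZMod 2))
    (hD : ∀ f, D f = ∑ j, C (eval x (pderiv j f)) * X j) :
    (∀ f ∈ J, ∀ g ∈ J, D (f + g) = D f + D g) ∧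
    (∀ c : ZMod 2, ∀ f ∈ J, D (c • f) = c • D f) ∧
    (∀ f ∈ J, D f ∈ L) ∧
    (∀ h ∈ L, ∃ f ∈ J, D f = h) := by
  subst hL hJ
  have hD_linear (c : Fin n → ZMod 2) : D (∑ j, C (c j) * X j) = ∑ j, C (c j) * X j := by
    simp only [hD, pderiv_sum_C_mul_X, eval_C]
  refine ⟨fun f _ g _ => ?_, fun c f _ => ?_, fun f hf => ?_, ?_⟩
  · simp [hD, add_mul, Finset.sum_add_distrib]
  · simp [hD, Finset.smul_sum, smul_eq_C_mul, mul_assoc]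
  · refine ⟨⟨_, hD f⟩, fun a ha => ?_⟩
    have key := sum_eval_pderiv_mul_eq_zero_of_mem_span (x := x) (a := a)
      (fun l hl => hl.2 x hx) ?_ hf.1
    · simpa [hD] using key.2
    · rintro l ⟨⟨c, rfl⟩, hl⟩
      simp only [pderiv_sum_C_mul_X, eval_C]
      simpa using hl a ha
  · rintro h ⟨⟨c, rfl⟩, hc⟩
    exact ⟨_, ⟨Ideal.subset_span ⟨⟨c, rfl⟩, hc⟩, (totalDegree_sum_C_mul_X_le c).trans hd⟩,
      hD_linear c⟩
end

section
/- Let A ⊆ F₂ⁿ be a linear subspace, let d ≥ 1 and m ≥ 1, fix a point x ∈ A, and let p₁, …, p_m be drawn independently and uniformly at random from J_{d,A}. Define K = {v ∈ F₂ⁿ : Σⱼ (pderiv_j pᵢ)(x) · (vⱼ + xⱼ) = 0 for all 1 ≤ i ≤ m} (the kernel of the Jacobian of p₁,…,p_m at x, translated by x). Then A ⊆ K always holds, and the probability that K = A is at least 1 − 2^{n−m}. -/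
open MvPolynomial

/-- The derivative at `x` in the direction `w`, as a linear functional on polynomials. -/
noncomputable def MvPolynomial.dirDeriv {σ R : Type*} [Fintype σ] [CommRing R] (x w : σ → R) :
    MvPolynomial σ R →ₗ[R] R :=
  ∑ j, w j • (aeval x).toLinearMap ∘ₗ (pderiv j).toLinearMap

theorem MvPolynomial.dirDeriv_apply {σ R : Type*} [Fintype σ] [CommRing R] (x w : σ → R)
    (p : MvPolynomial σ R) : dirDeriv x w p = ∑ j, eval x (pderiv j p) * w j := by
  simp [dirDeriv, mul_comm, aeval_eq_eval]

theorem MvPolynomial.dirDeriv_mul {σ R : Type*} [Fintype σ] [CommRing R] (x w : σ → R)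
    (p q : MvPolynomial σ R) :
    dirDeriv x w (p * q) = eval x p * dirDeriv x w q + eval x q * dirDeriv x w p := by
  simp only [dirDeriv_apply, Derivation.leibniz, smul_eq_mul, map_add, map_mul, add_mul,
    Finset.sum_add_distrib, Finset.mul_sum, mul_assoc]

theorem MvPolynomial.dirDeriv_linear {σ R : Type*} [Fintype σ] [CommRing R] (x w c : σ → R) :
    dirDeriv x w (∑ j, C (c j) * X j) = ∑ j, c j * w j := by
  classical
  simp [dirDeriv_apply, pderiv_X, Pi.single_apply, apply_ite]

theorem MvPolynomial.eval_linear {σ R : Type*} [Fintype σ] [CommRing R] (x c : σ → R) :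
    eval x (∑ j, C (c j) * X j) = ∑ j, c j * x j := by
  simp

theorem MvPolynomial.totalDegree_linear_le {σ R : Type*} [Fintype σ] [CommRing R] (c : σ → R) :
    (∑ j, C (c j) * X j : MvPolynomial σ R).totalDegree ≤ 1 := by
  refine totalDegree_finsetSum_le fun j _ ↦ ?_
  rw [C_mul_X_eq_monomial]
  exact (totalDegree_monomial_le _ _).trans (by simp)

/-- If the generators of an ideal vanish at `x` and have zero derivative in the direction `w`
there, the same holds for every element of the ideal. -/
theorem MvPolynomial.dirDeriv_eq_zero_of_mem_span {σ R : Type*} [Fintype σ] [CommRing R]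
    {x w : σ → R} {L : Set (MvPolynomial σ R)}
    (hL : ∀ h ∈ L, eval x h = 0 ∧ dirDeriv x w h = 0) {p : MvPolynomial σ R}
    (hp : p ∈ Ideal.span L) : eval x p = 0 ∧ dirDeriv x w p = 0 := by
  induction hp using Submodule.span_induction with
  | mem h hh => exact hL h hh
  | zero => simp
  | add p q _ _ hp hq => simp [hp, hq]
  | smul a p _ hp => simp [dirDeriv_mul, hp]

theorem MvPolynomial.finite_setOf_totalDegree_le (σ R : Type*) [Finite σ] [CommRing R] [Finite R]
    (d : ℕ) : {p : MvPolynomial σ R | p.totalDegree ≤ d}.Finite := by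
  have : Finite {n : σ →₀ ℕ | n.degree ≤ d} := Finsupp.finite_of_degree_le d
  have : Module.Finite R (restrictTotalDegree σ R d) :=
    .of_basis (basisRestrictSupport R {n : σ →₀ ℕ | n.degree ≤ d})
  have : Finite (restrictTotalDegree σ R d) := Module.finite_of_finite R
  refine (Set.toFinite (restrictTotalDegree σ R d : Set (MvPolynomial σ R))).subset fun p hp ↦ ?_
  exact (mem_restrictTotalDegree σ d p).2 hp

/-- A linear functional separating a point from a subspace of `Fⁿ`, in coordinates. -/
theorem Submodule.exists_coeff_of_notMem {ι F : Type*} [Fintype ι] [Field F]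
    {A : Submodule F (ι → F)} {v : ι → F} (hv : v ∉ A) :
    ∃ c : ι → F, (∀ a ∈ A, ∑ j, c j * a j = 0) ∧ ∑ j, c j * v j ≠ 0 := by
  classical
  obtain ⟨f, hfv, hfA⟩ := Submodule.exists_le_ker_of_notMem hv
  have key (a : ι → F) : ∑ j, f (Pi.single j 1) * a j = f a := by
    rw [f.pi_apply_eq_sum_univ a]
    exact Finset.sum_congr rfl fun j _ ↦ by
      rw [smul_eq_mul, mul_comm]
      congr 3
      ext i
      simp [Pi.single_apply, eq_comm]
  exact ⟨fun j ↦ f (Pi.single j 1), fun a ha ↦ by simpa [key] using hfA ha, by simpa [key]⟩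

theorem LinearMap.card_mul_card_ker_of_ne_zero {F M : Type*} [Field F] [AddCommGroup M]
    [Module F M] (f : M →ₗ[F] F) (hf : f ≠ 0) :
    Nat.card F * Nat.card f.ker = Nat.card M := by
  rw [Submodule.card_eq_card_quotient_mul_card f.ker, mul_comm,
    Nat.card_congr (f.quotKerEquivOfSurjective (LinearMap.surjective hf)).toEquiv]

/-- The number of `m`-tuples in the kernel of a nonzero functional. -/
theorem LinearMap.card_tuples_ker_of_ne_zero {F M : Type*} [Field F] [AddCommGroup M]
    [Module F M] (f : M →ₗ[F] F) (hf : f ≠ 0) (m : ℕ) :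
    Nat.card F ^ m * Nat.card {p : Fin m → M // ∀ i, f (p i) = 0} = Nat.card (Fin m → M) := by
  have h : Nat.card {p : Fin m → M // ∀ i, f (p i) = 0} = Nat.card f.ker ^ m := by
    rw [Nat.card_congr (Equiv.subtypePiEquivPi (p := fun _ y ↦ f y = 0))]
    simpa using Nat.card_fun (α := Fin m) (β := f.ker)
  rw [h, ← mul_pow, f.card_mul_card_ker_of_ne_zero hf, Nat.card_fun, Nat.card_fin]

/-- Union bound: a random `m`-tuple is in the kernel of none of the nonzero functionals `φ v`,
except with probability at most `|S| / |F| ^ m`. -/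
theorem card_tuples_le_of_forall_ne_zero {F M V : Type*} [Field F] [Finite F] [AddCommGroup M]
    [Module F M] [Finite M] (S : Finset V) (φ : V → M →ₗ[F] F) (hφ : ∀ v ∈ S, φ v ≠ 0) (m : ℕ) :
    Nat.card F ^ m * Nat.card (Fin m → M) ≤
      Nat.card F ^ m * Nat.card {p : Fin m → M // ∀ v ∈ S, ∃ i, φ v (p i) ≠ 0} +
        S.card * Nat.card (Fin m → M) := by
  classical
  have := Fintype.ofFinite M
  have hsub : (Finset.univ : Finset (Fin m → M)) ⊆
      Finset.univ.filter (fun p ↦ ∀ v ∈ S, ∃ i, φ v (p i) ≠ 0) ∪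
        S.biUnion fun v ↦ Finset.univ.filter fun p ↦ ∀ i, φ v (p i) = 0 := by
    intro p _
    simp only [Finset.mem_union, Finset.mem_filter, Finset.mem_univ, true_and, Finset.mem_biUnion]
    by_contra! h
    grind
  have hcard := (Finset.card_le_card hsub).trans ((Finset.card_union_le _ _).trans
    (Nat.add_le_add_left Finset.card_biUnion_le _))
  have hS : Nat.card F ^ m *
      ∑ v ∈ S, (Finset.univ.filter fun p : Fin m → M ↦ ∀ i, φ v (p i) = 0).card =
        S.card * Nat.card (Fin m → M) := by
    rw [Finset.mul_sum, ← smul_eq_mul, ← Finset.sum_const]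
    refine Finset.sum_congr rfl fun v hv ↦ ?_
    rw [← (φ v).card_tuples_ker_of_ne_zero (hφ v hv) m, Nat.card_eq_fintype_card (α := Subtype _),
      Fintype.card_subtype]
  rw [← hS, ← mul_add, Nat.card_eq_fintype_card (α := Subtype _), Fintype.card_subtype,
    Nat.card_eq_fintype_card (α := Fin m → M), ← Finset.card_univ]
  exact Nat.mul_le_mul_left _ hcard

/-- Let `A ⊆ F₂ⁿ` be a linear subspace, `d ≥ 1`, `m ≥ 1`, fix `x ∈ A`, and draw
`p₁, …, p_m` independently and uniformly from `J_{d,A}` (elements of total degree at most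
`d` of the ideal generated by the homogeneous linear polynomials vanishing on `A`).  Let
`K` be the kernel of the Jacobian of `p₁, …, p_m` at `x`, translated by `x`:
`K = {v : ∀ i, ∑ⱼ (pderiv j pᵢ)(x) · (vⱼ + xⱼ) = 0}`.  Then `A ⊆ K` always, and
`Pr[K = A] ≥ 1 - 2^(n-m)` for the uniform distribution on `(J_{d,A})^m`. -/
theorem stmt_7 (n d m : ℕ) (hd : 1 ≤ d) (hm : 1 ≤ m)
    (A : Submodule (ZMod 2) (Fin n → ZMod 2))
    (L : Set (MvPolynomial (Fin n) (ZMod 2)))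
    (hL : L = {h | (∃ c : Fin n → ZMod 2, h = ∑ j, C (c j) * X j) ∧ ∀ a ∈ A, eval a h = 0})
    (J : Set (MvPolynomial (Fin n) (ZMod 2)))
    (hJ : J = {f | f ∈ Ideal.span L ∧ f.totalDegree ≤ d})
    (x : Fin n → ZMod 2) (hx : x ∈ A)
    (K : (Fin m → J) → Set (Fin n → ZMod 2))
    (hK : ∀ p : Fin m → J, K p = {v | ∀ i : Fin m,
      ∑ j, eval x (pderiv j ((p i : MvPolynomial (Fin n) (ZMod 2)))) * (v j + x j) = 0}) :
    (∀ p : Fin m → J, (A : Set (Fin n → ZMod 2)) ⊆ K p) ∧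
    ((Nat.card {p : Fin m → J // K p = (A : Set (Fin n → ZMod 2))} : ℝ) /
        (Nat.card (Fin m → J) : ℝ)) ≥ 1 - (2 : ℝ) ^ ((n : ℤ) - (m : ℤ)) := by
  classical
  let J' : Submodule (ZMod 2) (MvPolynomial (Fin n) (ZMod 2)) :=
    (Ideal.span L).restrictScalars (ZMod 2) ⊓ restrictTotalDegree (Fin n) (ZMod 2) d
  have hJJ' : J = (J' : Set (MvPolynomial (Fin n) (ZMod 2))) := by
    ext p
    simp [hJ, J', mem_restrictTotalDegree]
  have hfin : Finite J' :=
    Set.Finite.to_subtype (s := J') <| (finite_setOf_totalDegree_le (Fin n) (ZMod 2) d).subset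
      fun p hp ↦ (mem_restrictTotalDegree _ _ p).1 hp.2
  have hker (a : Fin n → ZMod 2) (ha : a ∈ A) (p : J') : dirDeriv x a p = 0 := by
    refine (dirDeriv_eq_zero_of_mem_span (L := L) ?_ p.2.1).2
    rw [hL]
    rintro _ ⟨⟨c, rfl⟩, h⟩
    exact ⟨h x hx, by rw [dirDeriv_linear, ← eval_linear, h a ha]⟩
  have hne (v : Fin n → ZMod 2) (hv : v ∉ A) :
      (dirDeriv x (v + x)).domRestrict J' ≠ 0 := by
    obtain ⟨c, hcA, hcv⟩ := Submodule.exists_coeff_of_notMem (v := v + x)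
      (fun h ↦ hv ((A.add_mem_iff_left hx).1 h))
    have hc : ∑ j, C (c j) * X j ∈ J' := by
      refine ⟨Ideal.subset_span ?_, (mem_restrictTotalDegree _ _ _).2
        ((totalDegree_linear_le c).trans hd)⟩
      rw [hL]
      exact ⟨⟨c, rfl⟩, fun a ha ↦ by rw [eval_linear, hcA a ha]⟩
    intro h
    exact hcv ((dirDeriv_linear x (v + x) c).symm.trans (LinearMap.congr_fun h ⟨_, hc⟩))
  clear hJ
  subst hJJ'
  have hmem (p : Fin m → J') (v : Fin n → ZMod 2) :
      v ∈ K p ↔ ∀ i, dirDeriv x (v + x) (p i : MvPolynomial (Fin n) (ZMod 2)) = 0 := by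
    simp [hK, dirDeriv_apply]
  have hAK (p : Fin m → J') : (A : Set (Fin n → ZMod 2)) ⊆ K p := fun a ha ↦
    (hmem p a).2 fun i ↦ hker _ (A.add_mem ha hx) (p i)
  refine ⟨hAK, ?_⟩
  let S : Finset (Fin n → ZMod 2) := Finset.univ.filter (· ∉ A)
  have hgood (p : Fin m → J') : K p = (A : Set (Fin n → ZMod 2)) ↔
      ∀ v ∈ S, ∃ i, (dirDeriv x (v + x)).domRestrict J' (p i) ≠ 0 := by
    rw [(hAK p).ge_iff_eq'.symm]
    simp only [S, Finset.mem_filter, Finset.mem_univ, true_and, LinearMap.domRestrict_apply]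
    refine forall_congr' fun v ↦ ?_
    rw [hmem, ← not_forall, SetLike.mem_coe, not_imp_not]
  have hbound := card_tuples_le_of_forall_ne_zero S
    (fun v ↦ (dirDeriv x (v + x)).domRestrict J') (fun v hv ↦ hne v (by simpa [S] using hv)) m
  have hS : S.card ≤ 2 ^ n := (Finset.card_le_univ S).trans (by simp)
  have hpos : 0 < Nat.card (Fin m → J') := Nat.card_pos
  change ((Nat.card {p : Fin m → J' // K p = (A : Set (Fin n → ZMod 2))} : ℝ) /
    (Nat.card (Fin m → J') : ℝ)) ≥ _
  rw [Nat.card_congr (Equiv.subtypeEquivRight hgood)]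
  replace hbound := hbound.trans (Nat.add_le_add_left (Nat.mul_le_mul_right _ hS) _)
  rw [Nat.card_zmod] at hbound
  generalize Nat.card {p : Fin m → J' // _} = g at hbound ⊢
  generalize Nat.card (Fin m → J') = N at hbound hpos ⊢
  have hN : (0 : ℝ) < N := by exact_mod_cast hpos
  have hb : (2 : ℝ) ^ m * N ≤ 2 ^ m * g + 2 ^ n * N := by exact_mod_cast hbound
  rw [ge_iff_le, le_div_iff₀ hN, zpow_sub₀ two_ne_zero, zpow_natCast, zpow_natCast]
  have h2 : (0 : ℝ) < 2 ^ m := by positivity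
  rw [← mul_le_mul_iff_right₀ h2]
  field_simp
  linarith
end

section
/- Let A ⊆ F₂ⁿ be a linear subspace. In ℂ^{F₂ⁿ}, let P_A be the coordinate projection (P_A ψ)(x) = ψ(x) if x ∈ A and 0 otherwise, let P_{A^⊥} be defined analogously for A^⊥, let H be the n-qubit Hadamard transform (Hψ)(y) = 2^{−n/2} Σ_x χ(x·y) ψ(x), and let |A⟩ = (#A)^{−1/2} Σ_{x ∈ A} e_x. Then the operator V_A = H ∘ P_{A^⊥} ∘ H ∘ P_A equals the rank-one orthogonal projection |A⟩⟨A|; that is, for every ψ ∈ ℂ^{F₂ⁿ}, V_A ψ = ((#A)^{−1/2} Σ_{x ∈ A} ψ(x)) · |A⟩. -/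
open scoped Classical

/-- The standard dot product on `ι → K` as a bilinear form. -/
noncomputable abbrev dotForm (K ι : Type*) [Field K] [Fintype ι] : LinearMap.BilinForm K (ι → K) :=
  Matrix.toBilin' 1

section DotForm

variable {K ι : Type*} [Field K] [Fintype ι]

lemma dotForm_apply (x y : ι → K) : dotForm K ι x y = ∑ i, x i * y i := by
  simp [dotForm, Matrix.toBilin'_apply', dotProduct]

lemma dotForm_nondegenerate : (dotForm K ι).Nondegenerate :=
  LinearMap.BilinForm.nondegenerate_toBilin'_of_det_ne_zero' 1 (by simp)

lemma dotForm_isRefl : (dotForm K ι).IsRefl := fun x y h => by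
  rw [dotForm_apply] at h ⊢
  simpa only [mul_comm] using h

lemma mem_dotForm_orthogonal (A : Submodule K (ι → K)) (w : ι → K) :
    w ∈ (dotForm K ι).orthogonal A ↔ ∀ a ∈ A, ∑ i, w i * a i = 0 := by
  simp only [LinearMap.BilinForm.mem_orthogonal_iff, dotForm_apply, mul_comm]

lemma natCard_mul_natCard_dotForm_orthogonal (A : Submodule K (ι → K)) :
    Nat.card A * Nat.card ((dotForm K ι).orthogonal A) = Nat.card K ^ Fintype.card ι := by
  have hle := A.finrank_le
  rw [Module.natCard_eq_pow_finrank (K := K) (V := A),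
    Module.natCard_eq_pow_finrank (K := K) (V := (dotForm K ι).orthogonal A), ← pow_add,
    LinearMap.BilinForm.finrank_orthogonal dotForm_nondegenerate, Nat.add_sub_cancel' hle,
    Module.finrank_fintype_fun_eq_card]

end DotForm

lemma zmodTwo_sign_add {χ : ZMod 2 → ℂ} (hχ0 : χ 0 = 1) (hχ1 : χ 1 = -1) (a b : ZMod 2) :
    χ (a + b) = χ a * χ b := by
  have h11 : (1 + 1 : ZMod 2) = 0 := rfl
  have h01 : ∀ c : ZMod 2, c = 0 ∨ c = 1 := by decide
  rcases h01 a with rfl | rfl <;> rcases h01 b with rfl | rfl <;> simp [h11, hχ0, hχ1]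

/-- Orthogonality of characters on a subspace `W` of `F₂ⁿ`. -/
lemma sum_zmodTwo_sign_dot {ι : Type*} [Fintype ι] {χ : ZMod 2 → ℂ}
    (hχ0 : χ 0 = 1) (hχ1 : χ 1 = -1) (W : Submodule (ZMod 2) (ι → ZMod 2)) [Fintype W]
    (y : ι → ZMod 2) :
    ∑ w : W, χ (∑ i, (w : ι → ZMod 2) i * y i) =
      if y ∈ (dotForm (ZMod 2) ι).orthogonal W then (Nat.card W : ℂ) else 0 := by
  split_ifs with h
  · rw [Finset.sum_congr rfl (g := fun _ => (1 : ℂ))]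
    · simp [Nat.card_eq_fintype_card]
    · intro w _
      rw [← dotForm_apply, h w w.2, hχ0]
  · rw [LinearMap.BilinForm.mem_orthogonal_iff] at h
    push Not at h
    obtain ⟨v, hv, hvy⟩ := h
    have hv1 : dotForm (ZMod 2) ι v y = 1 := by
      have h01 : ∀ c : ZMod 2, c ≠ 0 → c = 1 := by decide
      exact h01 _ hvy
    simp only [← dotForm_apply]
    have key := Equiv.sum_comp (Equiv.addLeft (⟨v, hv⟩ : W))
      (fun w : W => χ (dotForm (ZMod 2) ι w y))
    simp only [Equiv.coe_addLeft, Submodule.coe_add, map_add, LinearMap.add_apply,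
      zmodTwo_sign_add hχ0 hχ1, hv1, hχ1, neg_one_mul, Finset.sum_neg_distrib] at key
    exact self_eq_neg.mp key.symm

/-- Let `A ⊆ F₂ⁿ` be a linear subspace, `P_A` and `P_{A^⊥}` the coordinate projections
onto `A` and `A^⊥`, `H` the `n`-qubit Hadamard transform, and `|A⟩` the uniform
superposition over `A`.  Then `V_A = H ∘ P_{A^⊥} ∘ H ∘ P_A` is the rank-one projection
`|A⟩⟨A|`: for every `ψ`, `V_A ψ = ((#A)^{-1/2} ∑_{x ∈ A} ψ(x)) · |A⟩`. -/
theorem stmt_11 (n : ℕ) (A : Submodule (ZMod 2) (Fin n → ZMod 2))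
    (χ : ZMod 2 → ℂ) (hχ0 : χ 0 = 1) (hχ1 : χ 1 = -1)
    (Aperp : Set (Fin n → ZMod 2))
    (hAperp : Aperp = {w | ∀ a ∈ A, ∑ i, w i * a i = 0})
    (H PA PAp : ((Fin n → ZMod 2) → ℂ) → ((Fin n → ZMod 2) → ℂ))
    (hH : ∀ ψ y, H ψ y =
      ((Real.sqrt (2 ^ n) : ℝ) : ℂ)⁻¹ * ∑ x, χ (∑ i, x i * y i) * ψ x)
    (hPA : ∀ ψ x, PA ψ x = if x ∈ A then ψ x else 0)
    (hPAp : ∀ ψ x, PAp ψ x = if x ∈ Aperp then ψ x else 0)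
    (ψA : (Fin n → ZMod 2) → ℂ)
    (hψA : ∀ x, ψA x =
      if x ∈ A then (((Real.sqrt (Nat.card A) : ℝ) : ℂ))⁻¹ else 0) :
    ∀ ψ : (Fin n → ZMod 2) → ℂ,
      H (PAp (H (PA ψ))) =
        ((((Real.sqrt (Nat.card A) : ℝ) : ℂ))⁻¹ * ∑ x : A, ψ x) • ψA := by
  intro ψ
  set B := (dotForm (ZMod 2) (Fin n)).orthogonal A with hB
  have hmem : ∀ w, w ∈ Aperp ↔ w ∈ B := fun w => by
    rw [hAperp, hB, mem_dotForm_orthogonal, Set.mem_ofPred_eq]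
  have hBB : (dotForm (ZMod 2) (Fin n)).orthogonal B = A :=
    LinearMap.BilinForm.orthogonal_orthogonal dotForm_nondegenerate dotForm_isRefl A
  have hsub : ∀ (W : Submodule (ZMod 2) (Fin n → ZMod 2)) (f : (Fin n → ZMod 2) → ℂ),
      ∑ x, (if x ∈ W then f x else 0) = ∑ x : W, f x := fun W f => by
    rw [← Finset.sum_filter]
    exact Finset.sum_subtype _ (by simp) f
  have hin : ∀ w ∈ B, H (PA ψ) w = ((Real.sqrt (2 ^ n) : ℝ) : ℂ)⁻¹ * ∑ x : A, ψ x := by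
    intro w hw
    rw [hH, ← hsub A ψ]
    congr 1
    refine Finset.sum_congr rfl fun x _ => ?_
    rw [hPA]
    split_ifs with hx
    · rw [← dotForm_apply, hw x hx, hχ0, one_mul]
    · rw [mul_zero]
  have hcard : (Nat.card A : ℂ) * Nat.card B = 2 ^ n := by
    have := natCard_mul_natCard_dotForm_orthogonal A
    rw [Nat.card_zmod, Fintype.card_fin] at this
    exact_mod_cast this
  have hA0 : (Nat.card A : ℂ) ≠ 0 := Nat.cast_ne_zero.mpr Nat.card_pos.ne'
  have hsqrt : ∀ r : ℝ, 0 ≤ r →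
      ((Real.sqrt r : ℝ) : ℂ)⁻¹ * ((Real.sqrt r : ℝ) : ℂ)⁻¹ = (r : ℂ)⁻¹ := fun r hr => by
    rw [← mul_inv, ← Complex.ofReal_mul, Real.mul_self_sqrt hr]
  have hs2 := hsqrt (2 ^ n) (by positivity)
  have hsA := hsqrt (Nat.card A) (by positivity)
  push_cast at hs2 hsA
  have hscal : (2 ^ n : ℂ)⁻¹ * Nat.card B = (Nat.card A : ℂ)⁻¹ := by
    have h2 : (2 ^ n : ℂ) ≠ 0 := pow_ne_zero _ two_ne_zero
    field_simp
    linear_combination hcard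
  funext y
  set S := ∑ x : A, ψ x
  set s := ((Real.sqrt (2 ^ n) : ℝ) : ℂ)⁻¹
  have hout : H (PAp (H (PA ψ))) y =
      s * s * S * ∑ w : B, χ (∑ i, (w : Fin n → ZMod 2) i * y i) := by
    rw [hH, ← hsub B fun w => χ (∑ i, w i * y i), mul_assoc s s, mul_assoc s,
      Finset.mul_sum Finset.univ _ (s * S)]
    congr 1
    refine Finset.sum_congr rfl fun w _ => ?_
    rw [hPAp]
    simp only [hmem]
    split_ifs with hw
    · rw [hin w hw, mul_comm]
    · simp
  rw [hout, sum_zmodTwo_sign_dot hχ0 hχ1, hBB, Pi.smul_apply, hψA, smul_eq_mul, hs2]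
  split_ifs
  · linear_combination S * hscal - S * hsA
  · simp
end

section
/- Let s ≥ 1 and let a, ã : Fin s → ℝ. Define u, ũ ∈ ℝ^{(Fin s → Bool)} by u(b) = Π_{i : b i = true} a_i and ũ(b) = Π_{i : b i = true} ã_i (empty products equal 1). Then u and ũ are nonzero, and setting F = ⟨u, ũ⟩ / (‖u‖ ‖ũ‖) (Euclidean inner product and norm), one has √(1 − F²) ≤ Σ_{i} |a_i − ã_i|. -/
theorem sum_prod_filter_bool {ι R : Type*} [Fintype ι] [DecidableEq ι] [CommSemiring R]
    (c : ι → R) :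
    ∑ b : ι → Bool, ∏ i ∈ Finset.univ.filter (fun i => b i = true), c i = ∏ i, (1 + c i) := by
  have h := Finset.prod_univ_sum (fun _ : ι => (Finset.univ : Finset Bool))
    (fun i b => if b = true then c i else 1)
  simp only [Fintype.sum_bool, if_true, Bool.false_eq_true, if_false, Fintype.piFinset_univ] at h
  simp only [Finset.prod_filter, add_comm (1 : R), h]

theorem one_sub_prod_one_sub_le_sum {ι : Type*} (t : Finset ι) (d : ι → ℝ)
    (h0 : ∀ i, 0 ≤ d i) (h1 : ∀ i, d i ≤ 1) : 1 - ∏ i ∈ t, (1 - d i) ≤ ∑ i ∈ t, d i := by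
  classical
  induction t using Finset.induction_on with
  | empty => simp
  | insert j t hj ih =>
    rw [Finset.prod_insert hj, Finset.sum_insert hj]
    have hp : ∏ i ∈ t, (1 - d i) ≤ 1 :=
      Finset.prod_le_one (fun i _ => by linarith [h1 i]) (fun i _ => by linarith [h0 i])
    nlinarith [mul_le_mul_of_nonneg_left hp (h0 j)]

/-- The squared overlap of `(1, x)` and `(1, y)` falls short of one by at most `(x - y) ^ 2`. -/
theorem one_sub_sq_overlap_bounds (x y : ℝ) :
    0 ≤ 1 - (1 + x * y) ^ 2 / ((1 + x ^ 2) * (1 + y ^ 2)) ∧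
    1 - (1 + x * y) ^ 2 / ((1 + x ^ 2) * (1 + y ^ 2)) ≤ 1 ∧
    1 - (1 + x * y) ^ 2 / ((1 + x ^ 2) * (1 + y ^ 2)) ≤ (x - y) ^ 2 := by
  have key : 1 - (1 + x * y) ^ 2 / ((1 + x ^ 2) * (1 + y ^ 2)) =
      (x - y) ^ 2 / ((1 + x ^ 2) * (1 + y ^ 2)) := by
    field_simp
    ring
  refine ⟨?_, ?_, ?_⟩
  · rw [key]; positivity
  · have : 0 ≤ (1 + x * y) ^ 2 / ((1 + x ^ 2) * (1 + y ^ 2)) := by positivity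
    linarith
  · rw [key]
    exact div_le_self (sq_nonneg _) (by nlinarith [sq_nonneg x, sq_nonneg y, sq_nonneg (x * y)])

/-- Let `s ≥ 1` and `a, ã : Fin s → ℝ` (here `ta`).  Define `u, ũ ∈ ℝ^{Fin s → Bool}`
(here `tu`) by `u b = ∏_{i : b i = true} a i` and `ũ b = ∏_{i : b i = true} ã i` (empty
products equal 1).  Then `u` and `ũ` are nonzero, and with
`F = ⟨u, ũ⟩ / (‖u‖ ‖ũ‖)` (Euclidean inner product and norm),
`√(1 − F²) ≤ ∑ᵢ |a i − ã i|`. -/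
theorem stmt_17 (s : ℕ) (hs : 1 ≤ s) (a ta : Fin s → ℝ)
    (u tu : (Fin s → Bool) → ℝ)
    (hu : ∀ b, u b = ∏ i ∈ Finset.univ.filter (fun i => b i = true), a i)
    (htu : ∀ b, tu b = ∏ i ∈ Finset.univ.filter (fun i => b i = true), ta i) :
    u ≠ 0 ∧ tu ≠ 0 ∧
    Real.sqrt (1 - ((∑ b, u b * tu b) /
        (Real.sqrt (∑ b, u b ^ 2) * Real.sqrt (∑ b, tu b ^ 2))) ^ 2) ≤
      ∑ i, |a i - ta i| := by
  have ne_zero : ∀ (c : Fin s → ℝ) (v : (Fin s → Bool) → ℝ),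
      (∀ b, v b = ∏ i ∈ Finset.univ.filter (fun i => b i = true), c i) → v ≠ 0 := by
    intro c v hv h
    have := hv (fun _ => false)
    simp [h] at this
  refine ⟨ne_zero a u hu, ne_zero ta tu htu, ?_⟩
  refine Real.sqrt_le_iff.mpr ⟨Finset.sum_nonneg fun i _ => abs_nonneg _, ?_⟩
  simp only [hu, htu, ← Finset.prod_mul_distrib, ← Finset.prod_pow, sum_prod_filter_bool]
  rw [div_pow, mul_pow, Real.sq_sqrt (Finset.prod_nonneg fun i _ => by positivity),
    Real.sq_sqrt (Finset.prod_nonneg fun i _ => by positivity), ← Finset.prod_mul_distrib,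
    ← Finset.prod_pow, ← Finset.prod_div_distrib]
  have h := one_sub_prod_one_sub_le_sum Finset.univ _
    (fun i => (one_sub_sq_overlap_bounds (a i) (ta i)).1)
    (fun i => (one_sub_sq_overlap_bounds (a i) (ta i)).2.1)
  simp only [sub_sub_cancel] at h
  calc _ ≤ _ := h
    _ ≤ ∑ i, |a i - ta i| ^ 2 := Finset.sum_le_sum fun i _ => by
      rw [sq_abs]; exact (one_sub_sq_overlap_bounds (a i) (ta i)).2.2
    _ ≤ (∑ i, |a i - ta i|) ^ 2 := Finset.sum_sq_le_sq_sum_of_nonneg fun i _ => abs_nonneg _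
end
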